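/- Let θ̂_u⁽ⁿ⁾, θ̂_b⁽ⁿ⁾, σ̂_u,n², σ̂_b,n², σ̂_bu,n be sequences of real-valued random variables on a probability space such that θ̂_u⁽ⁿ⁾ → θ₀ in probability, θ̂_b⁽ⁿ⁾ → θ₀ + μ in probability, n·σ̂_u,n² → ν_u in probability, n·σ̂_b,n² → ν_b in probability, and n·σ̂_bu,n → ν_bu in probability for finite real constants ν_u, ν_b, ν_bu, and such that (θ̂_u⁽ⁿ⁾ − θ̂_b⁽ⁿ⁾)² + σ̂_u,n² + σ̂_b,n² − 2σ̂_bu,n > 0 almost surely for each n. If μ ≠ 0, then the combination estimator θ̂_λ̂,n = λ̂_n·θ̂_b⁽ⁿ⁾ + (1 − λ̂_n)·θ̂_u⁽ⁿ⁾, where λ̂_n = (σ̂_u,n² − σ̂_bu,n)/((θ̂_u⁽ⁿ⁾ − θ̂_b⁽ⁿ⁾)² + σ̂_u,n² + σ̂_b,n² − 2σ̂_bu,n), converges to θ₀ in probability. -/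

import Mathlib

open MeasureTheory ProbabilityTheory Filter

namespace MeasureTheory.TendstoInMeasure

variable {Ω ι E F : Type*} [MeasurableSpace Ω] {P : Measure Ω} {l : Filter ι}

/-- Two sequences converging in measure converge jointly in measure. -/
theorem prodMk [PseudoEMetricSpace E] [PseudoEMetricSpace F]
    {f : ι → Ω → E} {f' : ι → Ω → F} {g : Ω → E} {g' : Ω → F}
    (hf : TendstoInMeasure P f l g) (hf' : TendstoInMeasure P f' l g') :
    TendstoInMeasure P (fun i ω => (f i ω, f' i ω)) l (fun ω => (g ω, g' ω)) := by
  intro ε hε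
  have hsum := (hf ε hε).add (hf' ε hε)
  rw [add_zero] at hsum
  refine tendsto_of_tendsto_of_tendsto_of_le_of_le tendsto_const_nhds hsum
    (fun _ => zero_le) fun i => (measure_mono fun ω hω => ?_).trans (measure_union_le _ _)
  simpa only [Set.mem_ofPred_eq, Set.mem_union, Prod.edist_eq, le_max_iff] using hω

/-- The continuous mapping theorem for convergence in measure to a constant. -/
theorem comp_continuousAt [PseudoEMetricSpace E] [PseudoEMetricSpace F]
    {f : ι → Ω → E} {a : E} {φ : E → F}
    (hf : TendstoInMeasure P f l (fun _ => a)) (hφ : ContinuousAt φ a) :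
    TendstoInMeasure P (fun i ω => φ (f i ω)) l (fun _ => φ a) := by
  intro ε hε
  obtain ⟨δ, hδ, hball⟩ := EMetric.mem_nhds_iff.1 (hφ (Metric.eball_mem_nhds _ hε))
  refine tendsto_of_tendsto_of_tendsto_of_le_of_le tendsto_const_nhds (hf δ hδ)
    (fun _ => zero_le) fun i => measure_mono fun ω hω => ?_
  by_contra hlt
  have hnear : edist (φ (f i ω)) (φ a) < ε := hball (Metric.mem_eball.2 (not_le.1 hlt))
  exact hnear.not_ge hω

/-- A convergent deterministic sequence converges in measure. -/
theorem of_tendsto_const [PseudoEMetricSpace E] {c : ι → E} {a : E}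
    (hc : Tendsto c l (nhds a)) :
    TendstoInMeasure P (fun i _ => c i) l (fun _ => a) := by
  intro ε hε
  refine tendsto_const_nhds.congr' ?_
  filter_upwards [hc (Metric.eball_mem_nhds _ hε)] with i hi
  simp [not_le.2 (Metric.mem_eball.1 hi)]

/-- If `n * f n` converges in measure to a finite constant, then `f n` converges to `0`. -/
theorem zero_of_natCast_mul {f : ℕ → Ω → ℝ} {c : ℝ}
    (hf : TendstoInMeasure P (fun (n : ℕ) ω => (n : ℝ) * f n ω) atTop (fun _ => c)) :
    TendstoInMeasure P f atTop (fun _ => 0) := by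
  have hinv : TendstoInMeasure P (fun (n : ℕ) _ => ((n : ℝ))⁻¹) atTop (fun _ => 0) :=
    of_tendsto_const tendsto_inv_atTop_nhds_zero_nat
  have hmul := (hinv.prodMk hf).comp_continuousAt (φ := fun p : ℝ × ℝ => p.1 * p.2)
    (by fun_prop)
  refine hmul.congr' ?_ (by simp)
  filter_upwards [eventually_ne_atTop 0] with n hn
  exact .of_forall fun ω => inv_mul_cancel_left₀ (Nat.cast_ne_zero.2 hn) _

end MeasureTheory.TendstoInMeasure

/-- If `θ̂_u⁽ⁿ⁾ → θ₀`, `θ̂_b⁽ⁿ⁾ → θ₀ + μ` in probability, the scaled variance/covariance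
estimates converge in probability to finite constants, and the denominator is a.s. positive,
then for `μ ≠ 0` the combination estimator `θ̂_λ̂,n = λ̂_n·θ̂_b⁽ⁿ⁾ + (1 − λ̂_n)·θ̂_u⁽ⁿ⁾`
converges to `θ₀` in probability. -/
theorem combination_estimator_consistent
    {Ω : Type*} [MeasurableSpace Ω] (P : Measure Ω) [IsProbabilityMeasure P]
    (θu θb σu2 σb2 σbu : ℕ → Ω → ℝ) (θ₀ μ νu νb νbu : ℝ)
    (hθu : TendstoInMeasure P θu atTop (fun _ => θ₀))
    (hθb : TendstoInMeasure P θb atTop (fun _ => θ₀ + μ))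
    (hσu : TendstoInMeasure P (fun (n : ℕ) ω => (n : ℝ) * σu2 n ω) atTop (fun _ => νu))
    (hσb : TendstoInMeasure P (fun (n : ℕ) ω => (n : ℝ) * σb2 n ω) atTop (fun _ => νb))
    (hσbu : TendstoInMeasure P (fun (n : ℕ) ω => (n : ℝ) * σbu n ω) atTop (fun _ => νbu))
    (hden : ∀ n, ∀ᵐ ω ∂P,
      (θu n ω - θb n ω) ^ 2 + σu2 n ω + σb2 n ω - 2 * σbu n ω > 0)
    (hμ : μ ≠ 0) :
    TendstoInMeasure P
      (fun n ω =>
        ((σu2 n ω - σbu n ω) /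
            ((θu n ω - θb n ω) ^ 2 + σu2 n ω + σb2 n ω - 2 * σbu n ω)) * θb n ω
        + (1 - (σu2 n ω - σbu n ω) /
            ((θu n ω - θb n ω) ^ 2 + σu2 n ω + σb2 n ω - 2 * σbu n ω)) * θu n ω)
      atTop (fun _ => θ₀) := by
  have hjoint := hθu.prodMk (hθb.prodMk
    (hσu.zero_of_natCast_mul.prodMk (hσb.zero_of_natCast_mul.prodMk hσbu.zero_of_natCast_mul)))
  have hlim := hjoint.comp_continuousAt (φ := fun p : ℝ × ℝ × ℝ × ℝ × ℝ =>
    ((p.2.2.1 - p.2.2.2.2) /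
        ((p.1 - p.2.1) ^ 2 + p.2.2.1 + p.2.2.2.1 - 2 * p.2.2.2.2)) * p.2.1
      + (1 - (p.2.2.1 - p.2.2.2.2) /
        ((p.1 - p.2.1) ^ 2 + p.2.2.1 + p.2.2.2.1 - 2 * p.2.2.2.2)) * p.1)
    (by fun_prop (disch := simpa using hμ))
  simpa using hlim
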